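/- arXiv:1904.06801 — 2 statements merged into one kernel-verified Lean document; each statement's English description precedes it below -/
import Mathlib

section
/- Let n ≥ 2, δ > 0, μ > 0 and T > 0. There exists a constant c > 0 depending only on n, δ, μ and T such that for every continuous f : ℝⁿ × [0,T] → ℝ with M := sup_{(y,s)} (1+|y|²)^{(δ+2)/2} |f(y,s)| < ∞, the volume heat potential (Ψ_μ f)(x,t) = ∫₀^t ∫_{ℝⁿ} ψ_μ(x−y, t−s) f(y,s) dy ds satisfies for all (x,t) ∈ ℝⁿ × (0,T]: (i) |(Ψ_μ f)(x,t)| ≤ c M (1+|x|²)^{−(δ+2)/2}; (ii) Ψ_μ f(·,t) is differentiable in x and |∂_i (Ψ_μ f)(x,t)| ≤ c M (1+|x|²)^{−(δ+2)/2} for every i = 1,…,n. -/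
open MeasureTheory

/-- The standard heat kernel `ψ_μ(x,t) = (4πμt)^{−n/2} exp(−|x|²/(4μt))` on `ℝⁿ` (for `t > 0`). -/
noncomputable def heatK (n : ℕ) (μ : ℝ) (x : EuclideanSpace ℝ (Fin n)) (t : ℝ) : ℝ :=
  (4 * Real.pi * μ * t) ^ (-(n : ℝ) / 2) * Real.exp (-‖x‖ ^ 2 / (4 * μ * t))

/-- The volume heat potential `(Ψ_μ f)(x,t) = ∫₀^t ∫ ψ_μ(x−y,t−s) f(y,s) dy ds`. -/
noncomputable def volpot (n : ℕ) (μ : ℝ) (f : EuclideanSpace ℝ (Fin n) → ℝ → ℝ)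
    (x : EuclideanSpace ℝ (Fin n)) (t : ℝ) : ℝ :=
  ∫ s in (0 : ℝ)..t, ∫ y : EuclideanSpace ℝ (Fin n), heatK n μ (x - y) (t - s) * f y s

/-- The spatial derivative of the heat kernel `heatK n μ · t`. -/
noncomputable def heatKDeriv (n : ℕ) (μ : ℝ) (x : EuclideanSpace ℝ (Fin n)) (t : ℝ) :
    EuclideanSpace ℝ (Fin n) →L[ℝ] ℝ :=
  (-(heatK n μ x t / (2 * μ * t))) • innerSL ℝ x

section HeatKernel

variable {n : ℕ} {μ τ T : ℝ}

lemma heatK_nonneg (hμ : 0 < μ) (hτ : 0 < τ) (z : EuclideanSpace ℝ (Fin n)) :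
    0 ≤ heatK n μ z τ := by
  unfold heatK
  positivity

lemma integral_heatK (hμ : 0 < μ) (hτ : 0 < τ) :
    ∫ z : EuclideanSpace ℝ (Fin n), heatK n μ z τ = 1 := by
  have h := GaussianFourier.integral_rexp_neg_mul_sq_norm (V := EuclideanSpace ℝ (Fin n))
    (b := 1 / (4 * μ * τ)) (by positivity)
  have h4 : 0 < 4 * Real.pi * μ * τ := by positivity
  have hb : Real.pi / (1 / (4 * μ * τ)) = 4 * Real.pi * μ * τ := by field_simp
  rw [hb, finrank_euclideanSpace_fin] at h
  have he : ∀ z : EuclideanSpace ℝ (Fin n),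
      -‖z‖ ^ 2 / (4 * μ * τ) = -(1 / (4 * μ * τ)) * ‖z‖ ^ 2 := fun z => by ring
  simp only [heatK, he]
  rw [integral_const_mul, h, ← Real.rpow_add h4, neg_div, neg_add_cancel, Real.rpow_zero]

lemma integrable_heatK (hμ : 0 < μ) (hτ : 0 < τ) :
    Integrable (fun z : EuclideanSpace ℝ (Fin n) => heatK n μ z τ) :=
  Integrable.of_integral_ne_zero (by rw [integral_heatK hμ hτ]; exact one_ne_zero)

lemma heatK_mul_exp (hμ : 0 < μ) (hτ : 0 < τ) (z : EuclideanSpace ℝ (Fin n)) :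
    heatK n μ z τ * Real.exp (‖z‖ ^ 2 / (8 * μ * τ)) =
      2 ^ ((n : ℝ) / 2) * heatK n (2 * μ) z τ := by
  have h4 : 0 ≤ 4 * Real.pi * μ * τ := by positivity
  unfold heatK
  rw [mul_assoc, ← Real.exp_add,
    show 4 * Real.pi * (2 * μ) * τ = 2 * (4 * Real.pi * μ * τ) by ring,
    Real.mul_rpow zero_le_two h4, ← mul_assoc, ← mul_assoc, ← Real.rpow_add two_pos,
    show (n : ℝ) / 2 + -(n : ℝ) / 2 = 0 by ring, Real.rpow_zero, one_mul]
  congr 2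
  field_simp
  ring

lemma one_add_rpow_le_exp {a p r : ℝ} (ha : 0 < a) (hp : 0 < p) (hr : 0 ≤ r) :
    (1 + r) ^ p ≤ (1 + p / a) ^ p * Real.exp (a * r) := by
  have h1 : 1 + r ≤ (1 + p / a) * Real.exp (a * r / p) := by
    calc 1 + r ≤ (1 + p / a) * (1 + a * r / p) := by
          have : (1 + p / a) * (1 + a * r / p) = 1 + r + (p / a + a * r / p) := by
            field_simp
            ring
          rw [this]
          have : 0 ≤ p / a + a * r / p := by positivity
          linarith
      _ ≤ _ := by
          gcongr
          rw [add_comm]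
          exact Real.add_one_le_exp _
  calc (1 + r) ^ p ≤ ((1 + p / a) * Real.exp (a * r / p)) ^ p := by gcongr
    _ = _ := by
      rw [Real.mul_rpow (by positivity) (Real.exp_nonneg _), ← Real.exp_mul,
        div_mul_cancel₀ _ hp.ne']

/-- On bounded time intervals, polynomial weights are absorbed by doubling the diffusion
constant. -/
lemma exists_heatK_mul_rpow_le (n : ℕ) {p : ℝ} (hμ : 0 < μ) (hT : 0 < T) (hp : 0 < p) :
    ∃ C : ℝ, 0 ≤ C ∧ ∀ τ, 0 < τ → τ ≤ T → ∀ z : EuclideanSpace ℝ (Fin n),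
      heatK n μ z τ * (1 + ‖z‖ ^ 2) ^ p ≤ C * heatK n (2 * μ) z τ := by
  set a : ℝ := 1 / (8 * μ * T) with ha
  have ha0 : 0 < a := by positivity
  refine ⟨(1 + p / a) ^ p * 2 ^ ((n : ℝ) / 2), by positivity, fun τ hτ hτT z => ?_⟩
  have hK := heatK_nonneg hμ hτ z
  calc heatK n μ z τ * (1 + ‖z‖ ^ 2) ^ p
      ≤ heatK n μ z τ * ((1 + p / a) ^ p * Real.exp (‖z‖ ^ 2 / (8 * μ * τ))) := by
        refine mul_le_mul_of_nonneg_left ?_ hK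
        refine (one_add_rpow_le_exp ha0 hp (by positivity)).trans ?_
        gcongr
        rw [ha, one_div_mul_eq_div]
        gcongr
    _ = _ := by rw [mul_left_comm, heatK_mul_exp hμ hτ, mul_assoc]

lemma norm_heatKDeriv_le (hμ : 0 < μ) (hτ : 0 < τ) (z : EuclideanSpace ℝ (Fin n)) :
    ‖heatKDeriv n μ z τ‖ ≤
      √(2 / μ) * 2 ^ ((n : ℝ) / 2) * τ ^ (-(1 / 2) : ℝ) * heatK n (2 * μ) z τ := by
  have hK := heatK_nonneg hμ hτ z
  have h8 : 0 < 8 * μ * τ := by positivity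
  have hs : 0 < √(8 * μ * τ) := Real.sqrt_pos.2 h8
  have hz : ‖z‖ ≤ √(8 * μ * τ) * Real.exp (‖z‖ ^ 2 / (8 * μ * τ)) := by
    have h1 : ‖z‖ / √(8 * μ * τ) ≤ Real.exp (‖z‖ ^ 2 / (8 * μ * τ)) := by
      have h2 : ‖z‖ ^ 2 / (8 * μ * τ) = (‖z‖ / √(8 * μ * τ)) ^ 2 := by
        rw [div_pow, Real.sq_sqrt h8.le]
      rw [h2]
      refine le_trans ?_ (Real.add_one_le_exp _)
      nlinarith [sq_nonneg (‖z‖ / √(8 * μ * τ) - 1)]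
    rw [div_le_iff₀ hs] at h1
    linarith
  have hc : √(8 * μ * τ) / (2 * μ * τ) = √(2 / μ) * τ ^ (-(1 / 2) : ℝ) := by
    rw [Real.rpow_neg hτ.le, ← Real.sqrt_eq_rpow, ← Real.sqrt_inv,
      ← Real.sqrt_mul (by positivity), eq_comm, Real.sqrt_eq_iff_mul_self_eq (by positivity)
      (by positivity), div_mul_div_comm, Real.mul_self_sqrt h8.le]
    field_simp
    ring
  calc ‖heatKDeriv n μ z τ‖ = heatK n μ z τ / (2 * μ * τ) * ‖z‖ := by
        rw [heatKDeriv, norm_smul, innerSL_apply_norm, norm_neg, Real.norm_of_nonneg (by positivity)]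
    _ ≤ heatK n μ z τ / (2 * μ * τ) *
          (√(8 * μ * τ) * Real.exp (‖z‖ ^ 2 / (8 * μ * τ))) := by gcongr
    _ = √(8 * μ * τ) / (2 * μ * τ) *
          (heatK n μ z τ * Real.exp (‖z‖ ^ 2 / (8 * μ * τ))) := by ring
    _ = _ := by rw [hc, heatK_mul_exp hμ hτ]; ring

lemma hasFDerivAt_heatK (z : EuclideanSpace ℝ (Fin n)) :
    HasFDerivAt (fun x => heatK n μ x τ) (heatKDeriv n μ z τ) z := by
  have h := ((((hasStrictFDerivAt_norm_sq z).hasFDerivAt.neg).mul_const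
    (4 * μ * τ)⁻¹).exp).const_mul ((4 * Real.pi * μ * τ) ^ (-(n : ℝ) / 2))
  refine (h.congr_fderiv ?_)
  ext v
  simp only [heatKDeriv, heatK, div_eq_mul_inv, smul_apply,
    neg_apply, smul_eq_mul, nsmul_eq_mul, Pi.neg_apply, mul_inv]
  push_cast
  simp
  ring

/-- A shift by at most one is absorbed by doubling the diffusion constant. -/
lemma heatK_add_le (hμ : 0 < μ) (hτ : 0 < τ) (z : EuclideanSpace ℝ (Fin n))
    {w : EuclideanSpace ℝ (Fin n)} (hw : ‖w‖ ≤ 1) :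
    heatK n μ (z + w) τ ≤
      Real.exp (1 / (4 * μ * τ)) * 2 ^ ((n : ℝ) / 2) * heatK n (2 * μ) z τ := by
  have h1 : ‖z‖ ^ 2 ≤ 2 * ‖z + w‖ ^ 2 + 2 := by
    have h2 : ‖z‖ ≤ ‖z + w‖ + ‖w‖ := by simpa using norm_sub_le (z + w) w
    nlinarith [sq_nonneg (‖z + w‖ - ‖w‖), norm_nonneg z, norm_nonneg w, norm_nonneg (z + w)]
  have h3 : Real.exp (-‖z + w‖ ^ 2 / (4 * μ * τ)) ≤ Real.exp (1 / (4 * μ * τ)) *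
      (Real.exp (-‖z‖ ^ 2 / (4 * μ * τ)) * Real.exp (‖z‖ ^ 2 / (8 * μ * τ))) := by
    rw [← Real.exp_add, ← Real.exp_add,
      show ‖z‖ ^ 2 / (8 * μ * τ) = (‖z‖ ^ 2 / 2) / (4 * μ * τ) by ring, ← add_div, ← add_div]
    gcongr
    linarith
  rw [mul_assoc, ← heatK_mul_exp hμ hτ]
  unfold heatK
  refine (mul_le_mul_of_nonneg_left h3 (by positivity)).trans_eq ?_
  ring

lemma one_add_norm_sq_rpow_le {p : ℝ} (hp : 0 ≤ p) (x y : EuclideanSpace ℝ (Fin n)) :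
    (1 + ‖x‖ ^ 2) ^ p ≤ 2 ^ p * (1 + ‖y‖ ^ 2) ^ p * (1 + ‖x - y‖ ^ 2) ^ p := by
  rw [← Real.mul_rpow zero_le_two (by positivity), ← Real.mul_rpow (by positivity) (by positivity)]
  refine Real.rpow_le_rpow (by positivity) ?_ hp
  have h2 : ‖x‖ ≤ ‖y‖ + ‖x - y‖ := by simpa using norm_add_le y (x - y)
  nlinarith [sq_nonneg (‖y‖ - ‖x - y‖), norm_nonneg x, norm_nonneg y, norm_nonneg (x - y),
    mul_nonneg (sq_nonneg ‖y‖) (sq_nonneg ‖x - y‖)]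

/-- Integration against a kernel with Gaussian decay preserves polynomial decay. -/
lemma norm_integral_smul_le {V : Type*} [NormedAddCommGroup V] [NormedSpace ℝ V] {p C M : ℝ}
    (hμ : 0 < μ) (hτ : 0 < τ) (hp : 0 ≤ p) (hM : 0 ≤ M)
    {k : EuclideanSpace ℝ (Fin n) → V} {F : EuclideanSpace ℝ (Fin n) → ℝ}
    (hk : ∀ z, ‖k z‖ * (1 + ‖z‖ ^ 2) ^ p ≤ C * heatK n μ z τ)
    (hF : ∀ y, (1 + ‖y‖ ^ 2) ^ p * |F y| ≤ M) (x : EuclideanSpace ℝ (Fin n)) :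
    ‖∫ y, F y • k (x - y)‖ ≤ C * (2 ^ p * M * (1 + ‖x‖ ^ 2) ^ (-p)) := by
  have hI := (integrable_heatK (n := n) hμ hτ).comp_sub_left x
  refine (norm_integral_le_of_norm_le (hI.const_mul (C * (2 ^ p * M * (1 + ‖x‖ ^ 2) ^ (-p))))
    (.of_forall fun y => ?_)).trans_eq ?_
  · have hx : 0 < (1 + ‖x‖ ^ 2) ^ p := by positivity
    rw [norm_smul, Real.norm_eq_abs, Real.rpow_neg (by positivity)]
    rw [show C * (2 ^ p * M * ((1 + ‖x‖ ^ 2) ^ p)⁻¹) * heatK n μ (x - y) τ =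
      (2 ^ p * M * (C * heatK n μ (x - y) τ)) / (1 + ‖x‖ ^ 2) ^ p by ring, le_div_iff₀ hx]
    calc |F y| * ‖k (x - y)‖ * (1 + ‖x‖ ^ 2) ^ p
        ≤ |F y| * ‖k (x - y)‖ * (2 ^ p * (1 + ‖y‖ ^ 2) ^ p * (1 + ‖x - y‖ ^ 2) ^ p) := by
          gcongr
          exact one_add_norm_sq_rpow_le hp x y
      _ = 2 ^ p * ((1 + ‖y‖ ^ 2) ^ p * |F y|) * (‖k (x - y)‖ * (1 + ‖x - y‖ ^ 2) ^ p) := by ring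
      _ ≤ _ := mul_le_mul (mul_le_mul_of_nonneg_left (hF y) (by positivity)) (hk _)
          (by positivity) (by positivity)
  · rw [integral_const_mul, integral_sub_left_eq_self (fun z => heatK n μ z τ),
      integral_heatK hμ hτ, mul_one]

lemma stronglyMeasurable_heatK (n : ℕ) (μ : ℝ) :
    StronglyMeasurable (fun q : EuclideanSpace ℝ (Fin n) × ℝ => heatK n μ q.1 q.2) := by
  refine Measurable.stronglyMeasurable ?_
  unfold heatK
  fun_prop

lemma stronglyMeasurable_heatKDeriv (n : ℕ) (μ : ℝ) :
    StronglyMeasurable (fun q : EuclideanSpace ℝ (Fin n) × ℝ => heatKDeriv n μ q.1 q.2) := by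
  unfold heatKDeriv
  have h : Measurable fun q : EuclideanSpace ℝ (Fin n) × ℝ => 2 * μ * q.2 := by fun_prop
  exact (((stronglyMeasurable_heatK n μ).measurable.div h).neg.stronglyMeasurable).smul
    ((innerSL ℝ).continuous.comp continuous_fst).stronglyMeasurable

lemma stronglyMeasurable_integral_smul {V : Type*} [NormedAddCommGroup V] [NormedSpace ℝ V]
    {k : EuclideanSpace ℝ (Fin n) → ℝ → V} {f : EuclideanSpace ℝ (Fin n) → ℝ → ℝ}
    (hk : StronglyMeasurable (fun q : EuclideanSpace ℝ (Fin n) × ℝ => k q.1 q.2))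
    (hf : Continuous (fun q : EuclideanSpace ℝ (Fin n) × ℝ => f q.1 q.2))
    (x : EuclideanSpace ℝ (Fin n)) (t : ℝ) :
    StronglyMeasurable (fun s => ∫ y, f y s • k (x - y) (t - s)) := by
  refine StronglyMeasurable.integral_prod_right (f := fun s y => f y s • k (x - y) (t - s)) ?_
  have h1 : Measurable fun q : ℝ × EuclideanSpace ℝ (Fin n) => (x - q.2, t - q.1) := by fun_prop
  exact (hf.comp continuous_swap).stronglyMeasurable.smul (hk.comp_measurable h1)

/-- For a bounded function `F`, the heat evolution of `F` is differentiable at positive times. -/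
lemma hasFDerivAt_integral_smul_heatK {B : ℝ} (hμ : 0 < μ) (hτ : 0 < τ)
    {F : EuclideanSpace ℝ (Fin n) → ℝ} (hF : Continuous F) (hB : ∀ y, |F y| ≤ B)
    (x : EuclideanSpace ℝ (Fin n)) :
    HasFDerivAt (fun x' => ∫ y, F y • heatK n μ (x' - y) τ)
      (∫ y, F y • heatKDeriv n μ (x - y) τ) x := by
  have hB0 : 0 ≤ B := (abs_nonneg _).trans (hB 0)
  have hm : ∀ x' : EuclideanSpace ℝ (Fin n),
      Measurable fun y : EuclideanSpace ℝ (Fin n) => (x' - y, τ) := fun x' => by fun_prop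
  set G : ℝ := √(2 / μ) * 2 ^ ((n : ℝ) / 2) * τ ^ (-(1 / 2) : ℝ)
  have hG0 : 0 ≤ G := by positivity
  set D : ℝ := Real.exp (1 / (4 * (2 * μ) * τ)) * 2 ^ ((n : ℝ) / 2)
  refine hasFDerivAt_integral_of_dominated_of_fderiv_le
    (F' := fun x' y => F y • heatKDeriv n μ (x' - y) τ)
    (bound := fun y => B * (G * D) * heatK n (2 * (2 * μ)) (x - y) τ)
    (s := Metric.closedBall x 1) (Metric.closedBall_mem_nhds x one_pos)
    (.of_forall fun x' => ?_) ?_ ?_ (.of_forall fun y x' hx' => ?_) ?_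
    (.of_forall fun y x' _ => ?_)
  · exact hF.aestronglyMeasurable.smul
      ((stronglyMeasurable_heatK n μ).comp_measurable (hm x')).aestronglyMeasurable
  · exact ((integrable_heatK hμ hτ).comp_sub_left x).bdd_mul hF.aestronglyMeasurable
      (.of_forall hB)
  · exact hF.aestronglyMeasurable.smul
      ((stronglyMeasurable_heatKDeriv n μ).comp_measurable (hm x)).aestronglyMeasurable
  · rw [norm_smul, mul_assoc, mul_assoc]
    refine mul_le_mul (hB y) ?_ (norm_nonneg _) hB0
    refine (norm_heatKDeriv_le hμ hτ _).trans (mul_le_mul_of_nonneg_left ?_ hG0)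
    have := heatK_add_le (μ := 2 * μ) (by positivity) hτ (x - y) (w := x' - x)
      (mem_closedBall_iff_norm.1 hx')
    rwa [show x - y + (x' - x) = x' - y by abel] at this
  · exact ((integrable_heatK (by positivity) hτ).comp_sub_left x).const_mul _
  · exact ((hasFDerivAt_heatK (x' - y)).comp x' ((hasFDerivAt_id x').sub_const y)).const_mul (F y)

lemma intervalIntegrable_sub_rpow_neg_half (t : ℝ) :
    IntervalIntegrable (fun s : ℝ => (t - s) ^ (-(1 / 2) : ℝ)) volume 0 t := by
  have h := (intervalIntegral.intervalIntegrable_rpow' (a := 0) (b := t)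
    (r := -(1 / 2)) (by norm_num)).comp_sub_left t
  simpa using h.symm

lemma integral_sub_rpow_neg_half (t : ℝ) :
    ∫ s in (0 : ℝ)..t, (t - s) ^ (-(1 / 2) : ℝ) = 2 * t ^ (1 / 2 : ℝ) := by
  rw [intervalIntegral.integral_comp_sub_left (fun s => s ^ (-(1 / 2) : ℝ)), sub_self, sub_zero,
    integral_rpow (Or.inl (by norm_num))]
  norm_num
  ring

end HeatKernel

/-- there is `c > 0` (depending only on `n`, `δ`, `μ`, `T`) such that for every
continuous `f` with `(1+|y|²)^{(δ+2)/2}|f(y,s)| ≤ M` on `ℝⁿ × [0,T]`: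
(i) `|(Ψ_μ f)(x,t)| ≤ c M (1+|x|²)^{−(δ+2)/2}`;
(ii) `Ψ_μ f(·,t)` is differentiable in `x` and `|∂_i(Ψ_μ f)(x,t)| ≤ c M (1+|x|²)^{−(δ+2)/2}`. -/
theorem statement15 (n : ℕ) (hn : 2 ≤ n) (δ μ T : ℝ)
    (hδ : 0 < δ) (hμ : 0 < μ) (hT : 0 < T) :
    ∃ c : ℝ, 0 < c ∧
      ∀ (f : EuclideanSpace ℝ (Fin n) → ℝ → ℝ) (M : ℝ),
        Continuous (fun z : EuclideanSpace ℝ (Fin n) × ℝ => f z.1 z.2) →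
        (∀ y s, s ∈ Set.Icc (0 : ℝ) T → (1 + ‖y‖ ^ 2) ^ ((δ + 2) / 2) * |f y s| ≤ M) →
        ∀ (x : EuclideanSpace ℝ (Fin n)) (t : ℝ), 0 < t → t ≤ T →
          |volpot n μ f x t| ≤ c * M * (1 + ‖x‖ ^ 2) ^ (-(δ + 2) / 2) ∧
          DifferentiableAt ℝ (fun x' => volpot n μ f x' t) x ∧
          ∀ i : Fin n,
            |fderiv ℝ (fun x' => volpot n μ f x' t) x (EuclideanSpace.single i 1)|
              ≤ c * M * (1 + ‖x‖ ^ 2) ^ (-(δ + 2) / 2) := by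
  set p : ℝ := (δ + 2) / 2 with hp
  have hp0 : 0 < p := by positivity
  rw [neg_div, ← hp]
  obtain ⟨C₁, hC₁, H₁⟩ := exists_heatK_mul_rpow_le n hμ hT hp0
  obtain ⟨C₂, hC₂, H₂⟩ := exists_heatK_mul_rpow_le n (μ := 2 * μ) (by positivity) hT hp0
  set G : ℝ := √(2 / μ) * 2 ^ ((n : ℝ) / 2)
  have hG : 0 ≤ G := by positivity
  have hK : ∀ τ, 0 < τ → τ ≤ T → ∀ z : EuclideanSpace ℝ (Fin n),
      ‖heatK n μ z τ‖ * (1 + ‖z‖ ^ 2) ^ p ≤ C₁ * heatK n (2 * μ) z τ := fun τ hτ hτT z => by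
    rw [Real.norm_of_nonneg (heatK_nonneg hμ hτ z)]
    exact H₁ τ hτ hτT z
  have hK' : ∀ τ, 0 < τ → τ ≤ T → ∀ z : EuclideanSpace ℝ (Fin n),
      ‖heatKDeriv n μ z τ‖ * (1 + ‖z‖ ^ 2) ^ p ≤
        G * τ ^ (-(1 / 2) : ℝ) * C₂ * heatK n (2 * (2 * μ)) z τ := fun τ hτ hτT z => by
    refine (mul_le_mul_of_nonneg_right (norm_heatKDeriv_le hμ hτ z) (by positivity)).trans ?_
    rw [mul_assoc, mul_assoc (G * _)]
    exact mul_le_mul_of_nonneg_left (H₂ τ hτ hτT z) (by positivity)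
  refine ⟨C₁ * 2 ^ p * T + G * C₂ * 2 ^ p * (2 * T ^ (1 / 2 : ℝ)) + 1, by positivity,
    fun f M hf hfM x t ht htT => ?_⟩
  have hM : 0 ≤ M := le_trans (by positivity) (hfM 0 0 ⟨le_rfl, hT.le⟩)
  set W : EuclideanSpace ℝ (Fin n) → ℝ := fun x => (1 + ‖x‖ ^ 2) ^ (-p)
  have hW0 : ∀ x, 0 ≤ W x := fun x => by positivity
  have hW1 : ∀ x, W x ≤ 1 := fun x =>
    Real.rpow_le_one_of_one_le_of_nonpos (by nlinarith [sq_nonneg ‖x‖]) (by linarith)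
  have hne : ∀ᵐ s : ℝ, s ≠ t := compl_mem_ae_iff.2 (measure_singleton t)
  have hτ : ∀ {s}, s ≠ t → s ∈ Set.Ioc 0 t → 0 < t - s ∧ t - s ≤ T := fun hs h =>
    ⟨sub_pos.2 (lt_of_le_of_ne h.2 hs), by linarith [h.1]⟩
  have hfs : ∀ {s}, s ∈ Set.Ioc 0 t → ∀ y, (1 + ‖y‖ ^ 2) ^ p * |f y s| ≤ M :=
    fun h y => hfM y _ ⟨h.1.le, h.2.trans htT⟩
  have hfb : ∀ {s}, s ∈ Set.Ioc 0 t → ∀ y, |f y s| ≤ M := fun h y =>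
    (le_mul_of_one_le_left (abs_nonneg _)
      (Real.one_le_rpow (by nlinarith [sq_nonneg ‖y‖]) hp0.le)).trans (hfs h y)
  have hb₁ : ∀ x', ∀ᵐ s : ℝ, s ∈ Set.Ioc 0 t →
      ‖∫ y, f y s • heatK n μ (x' - y) (t - s)‖ ≤ C₁ * (2 ^ p * M * W x') := fun x' => by
    filter_upwards [hne] with s hs h
    exact norm_integral_smul_le (by positivity) (hτ hs h).1 hp0.le hM
      (hK _ (hτ hs h).1 (hτ hs h).2) (hfs h) x'
  have hb₂ : ∀ᵐ s : ℝ, s ∈ Set.Ioc 0 t → ∀ x',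
      ‖∫ y, f y s • heatKDeriv n μ (x' - y) (t - s)‖ ≤
        G * C₂ * (2 ^ p * M * W x') * (t - s) ^ (-(1 / 2) : ℝ) := by
    filter_upwards [hne] with s hs h x'
    refine (norm_integral_smul_le (by positivity) (hτ hs h).1 hp0.le hM
      (hK' _ (hτ hs h).1 (hτ hs h).2) (hfs h) x').trans_eq ?_
    ring
  have hvol : ∀ x', volpot n μ f x' t =
      ∫ s in (0 : ℝ)..t, ∫ y, f y s • heatK n μ (x' - y) (t - s) := fun x' => by
    simp only [volpot, smul_eq_mul, mul_comm]
  have hm₁ := fun x' => stronglyMeasurable_integral_smul (stronglyMeasurable_heatK n μ) hf x' t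
  have hm₂ := stronglyMeasurable_integral_smul (stronglyMeasurable_heatKDeriv n μ) hf x t
  have hD : HasFDerivAt (fun x' => volpot n μ f x' t)
      (∫ s in (0 : ℝ)..t, ∫ y, f y s • heatKDeriv n μ (x - y) (t - s)) x := by
    simp only [hvol]
    refine intervalIntegral.hasFDerivAt_integral_of_dominated_of_fderiv_le
      (F' := fun x' s => ∫ y, f y s • heatKDeriv n μ (x' - y) (t - s))
      (bound := fun s => G * C₂ * (2 ^ p * M * 1) * (t - s) ^ (-(1 / 2) : ℝ))
      Filter.univ_mem (.of_forall fun x' => (hm₁ x').aestronglyMeasurable) ?_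
      hm₂.aestronglyMeasurable ?_
      ((intervalIntegrable_sub_rpow_neg_half t).const_mul _) ?_
    · refine (intervalIntegrable_const (c := C₁ * (2 ^ p * M * W x))).mono_fun'
        (hm₁ x).aestronglyMeasurable ?_
      rw [Set.uIoc_of_le ht.le]
      exact (ae_restrict_iff' measurableSet_Ioc).2 (hb₁ x)
    · rw [Set.uIoc_of_le ht.le]
      filter_upwards [hb₂, hne] with s hs hst h x' _
      refine (hs h x').trans ?_
      have := (hτ hst h).1
      gcongr
      exact hW1 x'
    · rw [Set.uIoc_of_le ht.le]
      filter_upwards [hne] with s hs h x' _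
      exact hasFDerivAt_integral_smul_heatK hμ (hτ hs h).1
        (hf.comp (continuous_id.prodMk continuous_const)) (hfb h) x'
  have hc₁ : C₁ * (2 ^ p * M * W x) * T ≤
      (C₁ * 2 ^ p * T + G * C₂ * 2 ^ p * (2 * T ^ (1 / 2 : ℝ)) + 1) * M * W x := by
    have : 0 ≤ (G * C₂ * 2 ^ p * (2 * T ^ (1 / 2 : ℝ)) + 1) * M * W x :=
      mul_nonneg (by positivity) (hW0 x)
    linarith
  have hc₂ : G * C₂ * (2 ^ p * M * W x) * (2 * T ^ (1 / 2 : ℝ)) ≤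
      (C₁ * 2 ^ p * T + G * C₂ * 2 ^ p * (2 * T ^ (1 / 2 : ℝ)) + 1) * M * W x := by
    have : 0 ≤ (C₁ * 2 ^ p * T + 1) * M * W x := mul_nonneg (by positivity) (hW0 x)
    linarith
  have hA₁ : 0 ≤ C₁ * (2 ^ p * M * W x) := by positivity
  have hA₂ : 0 ≤ G * C₂ * (2 ^ p * M * W x) := by positivity
  refine ⟨?_, hD.differentiableAt, fun i => ?_⟩
  · rw [hvol, ← Real.norm_eq_abs]
    refine (intervalIntegral.norm_integral_le_of_norm_le ht.le (hb₁ x)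
      intervalIntegrable_const).trans (le_trans ?_ hc₁)
    rw [intervalIntegral.integral_const, sub_zero, smul_eq_mul, mul_comm]
    gcongr
  · rw [hD.fderiv, ← Real.norm_eq_abs]
    refine (ContinuousLinearMap.le_opNorm _ _).trans ?_
    rw [PiLp.norm_single, norm_one, mul_one]
    refine (intervalIntegral.norm_integral_le_of_norm_le ht.le
      (hb₂.mono fun s hs h => hs h x)
      ((intervalIntegrable_sub_rpow_neg_half t).const_mul _)).trans (le_trans ?_ hc₂)
    rw [intervalIntegral.integral_const_mul, integral_sub_rpow_neg_half]
    gcongr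
end

section
/- (Uniqueness for the linearised Navier–Stokes equations.) Let n ≥ 2, μ > 0, T > 0 and δ > n/2. Let g : ℝⁿ × [0,T] → ℝ^{n×n} be continuous with g_{ij} = −g_{ji} and |g_{ij}(x,t)| ≤ C; let v¹ : ℝⁿ × [0,T] → ℝⁿ be continuous with |v¹(x,t)| ≤ C; let v² : ℝⁿ × [0,T] → ℝⁿ be continuous, C¹ in x, with |v²(x,t)| ≤ C w(x) and |∂_j v²_i(x,t)| ≤ C. Suppose u : ℝⁿ × [0,T] → ℝⁿ is continuous with continuous ∂_t u, ∂_i u, ∂_i∂_j u on ℝⁿ × [0,T] and weighted bounds |u| ≤ M w(x)^{−δ}, |∂_i u| ≤ M w(x)^{−δ−1}, |∂_i∂_j u| ≤ M w(x)^{−δ−2}, |∂_t u| ≤ M w(x)^{−δ}; suppose p : ℝⁿ × [0,T] → ℝ is continuous, C¹ in x, with |p| ≤ M w(x)^{1−δ} and |∂_j p| ≤ M w(x)^{−δ}. If div u = Σ_i ∂_i u_i = 0 on ℝⁿ × [0,T], the equations ∂_t u_j − μ Δ u_j + (V₀u)_j + ∂_j p = 0 hold on ℝⁿ × (0,T) for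 j = 1,…,n, and u(x,0) = 0 for all x, then u ≡ 0 and p ≡ 0 on ℝⁿ × [0,T]. -/
/-- The weight `w(x) = √(1+|x|²)`. -/
noncomputable def wgt {n : ℕ} (x : EuclideanSpace ℝ (Fin n)) : ℝ := Real.sqrt (1 + ‖x‖ ^ 2)

/-- Spatial partial derivative `∂_i` of a time-dependent scalar field on `ℝⁿ × ℝ`. -/
noncomputable def pdx {n : ℕ} (i : Fin n) (f : EuclideanSpace ℝ (Fin n) → ℝ → ℝ) :
    EuclideanSpace ℝ (Fin n) → ℝ → ℝ :=
  fun x t => fderiv ℝ (fun y => f y t) x (EuclideanSpace.single i 1)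

/-- The first-order operator
`(V₀u)_j = Σ_i g_{ij} u_i + Σ_i v¹_i (∂_i u_j − ∂_j u_i) + ∂_j (Σ_i v²_i u_i)`,
the componentwise form of `V₀u = ∗(∗g∧u) + ∗(∗d¹u ∧ v¹) + d⁰∗(∗v²∧u)`. -/
noncomputable def V0 {n : ℕ}
    (g : EuclideanSpace ℝ (Fin n) → ℝ → Fin n → Fin n → ℝ)
    (v1 v2 : EuclideanSpace ℝ (Fin n) → ℝ → Fin n → ℝ)
    (u : EuclideanSpace ℝ (Fin n) → ℝ → Fin n → ℝ) (j : Fin n) :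
    EuclideanSpace ℝ (Fin n) → ℝ → ℝ :=
  fun x t =>
    (∑ i, g x t i j * u x t i) +
    (∑ i, v1 x t i * (pdx i (fun y s => u y s j) x t - pdx j (fun y s => u y s i) x t)) +
    pdx j (fun y s => ∑ i, v2 y s i * u y s i) x t

section Weight

open MeasureTheory Filter Topology

variable {n : ℕ}

theorem wgt_pos (x : EuclideanSpace ℝ (Fin n)) : 0 < wgt x :=
  Real.sqrt_pos.2 (by positivity)

theorem one_le_wgt (x : EuclideanSpace ℝ (Fin n)) : 1 ≤ wgt x :=
  Real.one_le_sqrt.2 (by nlinarith [sq_nonneg ‖x‖])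

theorem wgt_sq (x : EuclideanSpace ℝ (Fin n)) : wgt x ^ 2 = 1 + ‖x‖ ^ 2 :=
  Real.sq_sqrt (by positivity)

theorem norm_le_wgt (x : EuclideanSpace ℝ (Fin n)) : ‖x‖ ≤ wgt x :=
  Real.le_sqrt_of_sq_le (by linarith)

theorem integrable_wgt_rpow {a : ℝ} (ha : a < -n) :
    Integrable (fun x : EuclideanSpace ℝ (Fin n) => wgt x ^ a) := by
  have h := integrable_rpow_neg_one_add_norm_sq (E := EuclideanSpace ℝ (Fin n)) (μ := volume)
    (r := -a) (by rw [finrank_euclideanSpace_fin]; linarith)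
  refine h.congr (Eventually.of_forall fun x => ?_)
  simp only [wgt, Real.sqrt_eq_rpow]
  rw [← Real.rpow_mul (by positivity)]
  congr 1
  ring

theorem abs_mul_le_wgt {x : EuclideanSpace ℝ (Fin n)} {r s A B a b c : ℝ}
    (hr : |r| ≤ A * wgt x ^ a) (hs : |s| ≤ B * wgt x ^ b) (hc : a + b = c) :
    |r * s| ≤ A * B * wgt x ^ c := by
  subst hc
  calc |r * s| = |r| * |s| := abs_mul r s
    _ ≤ (A * wgt x ^ a) * (B * wgt x ^ b) :=
        mul_le_mul hr hs (abs_nonneg _) ((abs_nonneg _).trans hr)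
    _ = A * B * wgt x ^ (a + b) := by rw [Real.rpow_add (wgt_pos x)]; ring

theorem integrable_of_abs_le_wgt {f : EuclideanSpace ℝ (Fin n) → ℝ} (hf : Measurable f)
    {A a : ℝ} (ha : a < -n) (h : ∀ x, |f x| ≤ A * wgt x ^ a) : Integrable f :=
  ((integrable_wgt_rpow ha).const_mul A).mono' hf.aestronglyMeasurable
    (Eventually.of_forall h)

theorem integrable_mul_of_abs_le_wgt {f g : EuclideanSpace ℝ (Fin n) → ℝ} (hf : Measurable f)
    (hg : Measurable g) {A B a b : ℝ} (hab : a + b < -n) (hfA : ∀ x, |f x| ≤ A * wgt x ^ a)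
    (hgB : ∀ x, |g x| ≤ B * wgt x ^ b) : Integrable (fun x => f x * g x) :=
  integrable_of_abs_le_wgt (hf.mul hg) hab fun x => abs_mul_le_wgt (hfA x) (hgB x) rfl

/-- The `i`-th partial derivative of a scalar field on `ℝⁿ`. -/
noncomputable def partialDeriv (i : Fin n) (f : EuclideanSpace ℝ (Fin n) → ℝ) :
    EuclideanSpace ℝ (Fin n) → ℝ :=
  fun x => fderiv ℝ f x (EuclideanSpace.single i 1)

theorem measurable_partialDeriv (i : Fin n) (f : EuclideanSpace ℝ (Fin n) → ℝ) :
    Measurable (partialDeriv i f) :=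
  measurable_fderiv_apply_const ℝ f _

theorem partialDeriv_mul (i : Fin n) {f g : EuclideanSpace ℝ (Fin n) → ℝ}
    {x : EuclideanSpace ℝ (Fin n)} (hf : DifferentiableAt ℝ f x) (hg : DifferentiableAt ℝ g x) :
    partialDeriv i (fun y => f y * g y) x
      = partialDeriv i f x * g x + f x * partialDeriv i g x := by
  simp only [partialDeriv]
  rw [fderiv_fun_mul hf hg]
  simp
  ring

theorem integral_mul_partialDeriv (i : Fin n) {f g : EuclideanSpace ℝ (Fin n) → ℝ}
    (hf : Differentiable ℝ f) (hg : Differentiable ℝ g)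
    (hf'g : Integrable (fun x => partialDeriv i f x * g x))
    (hfg' : Integrable (fun x => f x * partialDeriv i g x))
    (hfg : Integrable (fun x => f x * g x)) :
    ∫ x, f x * partialDeriv i g x = - ∫ x, partialDeriv i f x * g x :=
  integral_mul_fderiv_eq_neg_fderiv_mul_of_integrable hf'g hfg' hfg
    (fun x _ => hf x) (fun x _ => hg x)

/-- A smooth weight decaying like `ε⁻¹ |x|⁻²`, which tends to `1` as `ε → 0`. -/
noncomputable def damping (ε : ℝ) (x : EuclideanSpace ℝ (Fin n)) : ℝ := (1 + ε * ‖x‖ ^ 2)⁻¹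

theorem differentiable_damping {ε : ℝ} (hε : 0 < ε) :
    Differentiable ℝ (damping ε : EuclideanSpace ℝ (Fin n) → ℝ) := fun x => by
  unfold damping
  have h : DifferentiableAt ℝ (fun x : EuclideanSpace ℝ (Fin n) => 1 + ε * ‖x‖ ^ 2) x := by
    have := (contDiff_norm_sq ℝ (E := EuclideanSpace ℝ (Fin n)) (n := 1)).differentiable
      one_ne_zero x
    fun_prop
  exact h.inv (by positivity)

theorem partialDeriv_damping {ε : ℝ} (hε : 0 < ε) (i : Fin n) (x : EuclideanSpace ℝ (Fin n)) :
    partialDeriv i (damping ε) x = -(2 * ε * x i) * damping ε x ^ 2 := by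
  have h0 : HasFDerivAt (fun x : EuclideanSpace ℝ (Fin n) => 1 + ε * ‖x‖ ^ 2)
      (ε • (2 • innerSL ℝ x)) x :=
    (((hasStrictFDerivAt_norm_sq x).hasFDerivAt).const_mul ε).const_add 1
  have hne : (1 + ε * ‖x‖ ^ 2) ≠ 0 := by positivity
  have h1 := (hasDerivAt_inv hne).comp_hasFDerivAt x h0
  have h2 : fderiv ℝ (damping ε) x = _ := h1.fderiv
  simp only [partialDeriv, h2, damping]
  simp [EuclideanSpace.inner_single_right]
  ring

theorem abs_damping_le_one {ε : ℝ} (hε : 0 < ε) (x : EuclideanSpace ℝ (Fin n)) :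
    |damping ε x| ≤ 1 := by
  unfold damping
  rw [abs_of_pos (by positivity)]
  exact inv_le_one_of_one_le₀ (by nlinarith [mul_nonneg hε.le (sq_nonneg ‖x‖)])

theorem abs_damping_le {ε : ℝ} (hε : 0 < ε) (hε1 : ε ≤ 1) (x : EuclideanSpace ℝ (Fin n)) :
    |damping ε x| ≤ ε⁻¹ * wgt x ^ (-2 : ℝ) := by
  unfold damping
  rw [abs_of_pos (by positivity), Real.rpow_neg (wgt_pos x).le, Real.rpow_two, wgt_sq,
    ← mul_inv]
  exact inv_anti₀ (by positivity) (by linarith)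

theorem abs_partialDeriv_damping_le {ε : ℝ} (hε : 0 < ε) (hε1 : ε ≤ 1) (i : Fin n)
    (x : EuclideanSpace ℝ (Fin n)) :
    |partialDeriv i (damping ε) x| ≤ 2 * wgt x ^ (-1 : ℝ) := by
  have hw := wgt_pos x
  have hxi : |x i| ≤ wgt x := (PiLp.norm_apply_le x i).trans (norm_le_wgt x)
  rw [partialDeriv_damping hε, Real.rpow_neg hw.le, Real.rpow_one, ← div_eq_mul_inv,
    le_div_iff₀ hw, abs_mul, abs_neg, abs_mul, abs_of_pos (by positivity : 0 < 2 * ε), damping,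
    abs_of_nonneg (by positivity : 0 ≤ (1 + ε * ‖x‖ ^ 2)⁻¹ ^ 2)]
  have hd : 0 < 1 + ε * ‖x‖ ^ 2 := by positivity
  have h1 : |x i| * wgt x ≤ 1 + ‖x‖ ^ 2 := by
    rw [← wgt_sq, sq]
    exact mul_le_mul_of_nonneg_right hxi hw.le
  have h2 : ε * (|x i| * wgt x) ≤ 1 + ε * ‖x‖ ^ 2 :=
    (mul_le_mul_of_nonneg_left h1 hε.le).trans (by linarith)
  have h3 : (1 + ε * ‖x‖ ^ 2)⁻¹ ≤ 1 :=
    inv_le_one_of_one_le₀ (by nlinarith [mul_nonneg hε.le (sq_nonneg ‖x‖)])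
  calc 2 * ε * |x i| * (1 + ε * ‖x‖ ^ 2)⁻¹ ^ 2 * wgt x
      = 2 * (ε * (|x i| * wgt x)) * (1 + ε * ‖x‖ ^ 2)⁻¹ * (1 + ε * ‖x‖ ^ 2)⁻¹ := by ring
    _ ≤ 2 * (1 + ε * ‖x‖ ^ 2) * (1 + ε * ‖x‖ ^ 2)⁻¹ * 1 := by gcongr
    _ = 2 := by field_simp

theorem tendsto_damping (x : EuclideanSpace ℝ (Fin n)) :
    Tendsto (fun ε => damping ε x) (𝓝[>] 0) (𝓝 1) := by
  have h : ContinuousAt (fun ε : ℝ => damping ε x) 0 := by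
    unfold damping
    exact ContinuousAt.inv₀ (by fun_prop) (by simp)
  have h' : Tendsto (fun ε : ℝ => damping ε x) (𝓝 0) (𝓝 1) := by
    simpa [damping] using h.tendsto
  exact h'.mono_left nhdsWithin_le_nhds

theorem tendsto_partialDeriv_damping (i : Fin n) (x : EuclideanSpace ℝ (Fin n)) :
    Tendsto (fun ε => partialDeriv i (damping ε) x) (𝓝[>] 0) (𝓝 0) := by
  have h : Tendsto (fun ε : ℝ => -(2 * ε * x i) * damping ε x ^ 2) (𝓝[>] 0)
      (𝓝 (-(2 * 0 * x i) * 1 ^ 2)) := by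
    refine Tendsto.mul ?_ ((tendsto_damping x).pow 2)
    have : Continuous fun ε : ℝ => -(2 * ε * x i) := by fun_prop
    exact (this.tendsto 0).mono_left nhdsWithin_le_nhds
  simp only [mul_zero, zero_mul, neg_zero] at h
  exact h.congr' (eventually_mem_nhdsWithin.mono fun ε hε => (partialDeriv_damping hε i x).symm)

/-- A decaying divergence-free field is `L²`-orthogonal to gradients. -/
theorem integral_sum_mul_partialDeriv_eq_zero {δ A B B' : ℝ} (hδ : (n : ℝ) / 2 < δ)
    {u : EuclideanSpace ℝ (Fin n) → Fin n → ℝ} {q : EuclideanSpace ℝ (Fin n) → ℝ}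
    (hu : ∀ j, Differentiable ℝ (fun x => u x j)) (hq : Differentiable ℝ q)
    (hu0 : ∀ x j, |u x j| ≤ A * wgt x ^ (-δ))
    (hu1 : ∀ x j, |partialDeriv j (fun y => u y j) x| ≤ A * wgt x ^ (-δ - 1))
    (hq0 : ∀ x, |q x| ≤ B * wgt x ^ (1 - δ))
    (hq1 : ∀ x j, |partialDeriv j q x| ≤ B' * wgt x ^ (-δ))
    (hdiv : ∀ x, ∑ j, partialDeriv j (fun y => u y j) x = 0) :
    ∫ x, ∑ j, u x j * partialDeriv j q x = 0 := by
  have hum : ∀ j, Measurable (fun x => u x j) := fun j => (hu j).continuous.measurable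
  have hqm : Measurable q := hq.continuous.measurable
  have hdm : ∀ ε : ℝ, 0 < ε → Measurable (damping ε : EuclideanSpace ℝ (Fin n) → ℝ) :=
    fun ε hε => (differentiable_damping hε).continuous.measurable
  have hparts : ∀ ε : ℝ, 0 < ε → ε ≤ 1 →
      ∫ x, damping ε x * ∑ j, u x j * partialDeriv j q x
        = -∫ x, ∑ j, partialDeriv j (damping ε) x * (u x j * q x) := by
    intro ε hε hε1
    have hd := differentiable_damping (n := n) hε
    have hd1 : ∀ x : EuclideanSpace ℝ (Fin n), |damping ε x| ≤ 1 * wgt x ^ (0 : ℝ) := by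
      simpa using abs_damping_le_one (n := n) hε
    have hprod : ∀ x j, partialDeriv j (fun y => damping ε y * u y j) x
        = partialDeriv j (damping ε) x * u x j
          + damping ε x * partialDeriv j (fun y => u y j) x :=
      fun x j => partialDeriv_mul j (hd x) (hu j x)
    have h_int1 : ∀ j, Integrable (fun x => damping ε x * u x j * partialDeriv j q x) :=
      fun j => integrable_mul_of_abs_le_wgt (a := -δ) (b := -δ) ((hdm ε hε).mul (hum j))
        (measurable_partialDeriv j q) (by linarith)
        (fun x => abs_mul_le_wgt (hd1 x) (hu0 x j) (by ring)) (fun x => hq1 x j)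
    have h_int2 : ∀ j, Integrable (fun x => damping ε x * u x j * q x) :=
      fun j => integrable_mul_of_abs_le_wgt (a := -2 - δ) (b := 1 - δ)
        ((hdm ε hε).mul (hum j)) hqm (by linarith)
        (fun x => abs_mul_le_wgt (abs_damping_le hε hε1 x) (hu0 x j) (by ring)) hq0
    have h_int3 : ∀ j, Integrable (fun x => partialDeriv j (damping ε) x * u x j * q x) :=
      fun j => integrable_mul_of_abs_le_wgt (a := -1 - δ) (b := 1 - δ)
        ((measurable_partialDeriv _ _).mul (hum j)) hqm (by linarith)
        (fun x => abs_mul_le_wgt (abs_partialDeriv_damping_le hε hε1 j x) (hu0 x j) (by ring))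
        hq0
    have h_int4 : ∀ j, Integrable
        (fun x => damping ε x * partialDeriv j (fun y => u y j) x * q x) :=
      fun j => integrable_mul_of_abs_le_wgt (a := -δ - 1) (b := 1 - δ)
        ((hdm ε hε).mul (measurable_partialDeriv _ _)) hqm (by linarith)
        (fun x => abs_mul_le_wgt (hd1 x) (hu1 x j) (by ring)) hq0
    have h_int5 : ∀ j, Integrable
        (fun x => partialDeriv j (fun y => damping ε y * u y j) x * q x) := fun j => by
      simp only [hprod, add_mul]
      exact (h_int3 j).add (h_int4 j)
    calc ∫ x, damping ε x * ∑ j, u x j * partialDeriv j q x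
        = ∫ x, ∑ j, damping ε x * u x j * partialDeriv j q x := by
          simp only [Finset.mul_sum, mul_assoc]
      _ = ∑ j, ∫ x, damping ε x * u x j * partialDeriv j q x :=
          integral_finsetSum _ fun j _ => h_int1 j
      _ = ∑ j, -∫ x, partialDeriv j (fun y => damping ε y * u y j) x * q x :=
          Finset.sum_congr rfl fun j _ =>
            integral_mul_partialDeriv j (hd.mul (hu j)) hq (h_int5 j) (h_int1 j) (h_int2 j)
      _ = -∫ x, ∑ j, partialDeriv j (fun y => damping ε y * u y j) x * q x := by
          rw [Finset.sum_neg_distrib, integral_finsetSum _ fun j _ => h_int5 j]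
      _ = -∫ x, ∑ j, partialDeriv j (damping ε) x * (u x j * q x) := by
          congr 2
          funext x
          have h0 : ∑ j, damping ε x * partialDeriv j (fun y => u y j) x * q x = 0 := by
            rw [← Finset.sum_mul, ← Finset.mul_sum, hdiv, mul_zero, zero_mul]
          simp only [hprod, add_mul, Finset.sum_add_distrib, h0, add_zero]
          simp only [mul_assoc]
  have hsmall : ∀ᶠ ε : ℝ in 𝓝[>] 0, 0 < ε ∧ ε ≤ 1 := by
    filter_upwards [Ioc_mem_nhdsGT (zero_lt_one' ℝ)] with ε hε using hε
  have hbound : Integrable (fun x : EuclideanSpace ℝ (Fin n) =>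
      ∑ _j : Fin n, 2 * (A * B) * wgt x ^ (-2 * δ)) :=
    integrable_finsetSum _ fun j _ => (integrable_wgt_rpow (by linarith)).const_mul _
  have hbound' : Integrable (fun x : EuclideanSpace ℝ (Fin n) =>
      ∑ _j : Fin n, A * B' * wgt x ^ (-2 * δ)) :=
    integrable_finsetSum _ fun j _ => (integrable_wgt_rpow (by linarith)).const_mul _
  have hleft : Tendsto (fun ε : ℝ => ∫ x, damping ε x * ∑ j, u x j * partialDeriv j q x)
      (𝓝[>] 0) (𝓝 (∫ x, ∑ j, u x j * partialDeriv j q x)) := by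
    refine tendsto_integral_filter_of_dominated_convergence _ ?_ ?_ hbound' ?_
    · filter_upwards [hsmall] with ε hε
      exact ((hdm ε hε.1).mul (Finset.measurable_fun_sum _ fun j _ =>
        (hum j).mul (measurable_partialDeriv j q))).aestronglyMeasurable
    · filter_upwards [hsmall] with ε hε
      refine Eventually.of_forall fun x => ?_
      rw [Real.norm_eq_abs, abs_mul]
      calc |damping ε x| * |∑ j, u x j * partialDeriv j q x|
          ≤ 1 * |∑ j, u x j * partialDeriv j q x| :=
            mul_le_mul_of_nonneg_right (abs_damping_le_one hε.1 x) (abs_nonneg _)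
        _ ≤ ∑ j, |u x j * partialDeriv j q x| := by
            rw [one_mul]; exact Finset.abs_sum_le_sum_abs _ _
        _ ≤ _ := Finset.sum_le_sum fun j _ =>
            abs_mul_le_wgt (hu0 x j) (hq1 x j) (by ring)
    · refine Eventually.of_forall fun x => ?_
      simpa using (tendsto_damping x).mul_const (∑ j, u x j * partialDeriv j q x)
  have hright : Tendsto
      (fun ε : ℝ => ∫ x, ∑ j, partialDeriv j (damping ε) x * (u x j * q x))
      (𝓝[>] 0) (𝓝 (∫ _x : EuclideanSpace ℝ (Fin n), (0 : ℝ))) := by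
    refine tendsto_integral_filter_of_dominated_convergence _ ?_ ?_ hbound ?_
    · exact Eventually.of_forall fun ε => (Finset.measurable_fun_sum _ fun j _ =>
        (measurable_partialDeriv j _).mul ((hum j).mul hqm)).aestronglyMeasurable
    · filter_upwards [hsmall] with ε hε
      refine Eventually.of_forall fun x => ?_
      rw [Real.norm_eq_abs]
      exact (Finset.abs_sum_le_sum_abs _ _).trans (Finset.sum_le_sum fun j _ =>
        abs_mul_le_wgt (abs_partialDeriv_damping_le hε.1 hε.2 j x)
          (abs_mul_le_wgt (hu0 x j) (hq0 x) rfl) (by ring))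
    · refine Eventually.of_forall fun x => ?_
      simpa using tendsto_finsetSum Finset.univ fun j _ =>
        (tendsto_partialDeriv_damping j x).mul_const (u x j * q x)
  have hright' := hright.neg
  rw [integral_zero, neg_zero] at hright'
  exact tendsto_nhds_unique hleft
    (hright'.congr' (hsmall.mono fun ε hε => (hparts ε hε.1 hε.2).symm))

/-- Green's identity for decaying functions. -/
theorem integral_mul_partialDeriv_partialDeriv {δ A : ℝ} (hδ : (n : ℝ) / 2 < δ) (i : Fin n)
    {f : EuclideanSpace ℝ (Fin n) → ℝ} (hf : Differentiable ℝ f)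
    (hf' : Differentiable ℝ (partialDeriv i f))
    (hf0 : ∀ x, |f x| ≤ A * wgt x ^ (-δ))
    (hf1 : ∀ x, |partialDeriv i f x| ≤ A * wgt x ^ (-δ - 1))
    (hf2 : ∀ x, |partialDeriv i (partialDeriv i f) x| ≤ A * wgt x ^ (-δ - 2)) :
    Integrable (fun x => f x * partialDeriv i (partialDeriv i f) x + partialDeriv i f x ^ 2) ∧
    ∫ x, (f x * partialDeriv i (partialDeriv i f) x + partialDeriv i f x ^ 2) = 0 := by
  have hm := hf.continuous.measurable
  have hm' := measurable_partialDeriv i f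
  have h1 : Integrable (fun x => f x * partialDeriv i (partialDeriv i f) x) :=
    integrable_mul_of_abs_le_wgt hm (measurable_partialDeriv i _) (by linarith) hf0 hf2
  have h2 : Integrable (fun x => partialDeriv i f x * partialDeriv i f x) :=
    integrable_mul_of_abs_le_wgt hm' hm' (by linarith) hf1 hf1
  have h3 : Integrable (fun x => f x * partialDeriv i f x) :=
    integrable_mul_of_abs_le_wgt hm hm' (by linarith) hf0 hf1
  simp only [sq]
  refine ⟨h1.add h2, ?_⟩
  rw [integral_add h1 h2, integral_mul_partialDeriv i hf hf' h2 h1 h3, neg_add_cancel]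

theorem sum_mul_le_of_momentum_eq {μ C : ℝ} (hμ : 0 < μ) {u a Q v : Fin n → ℝ}
    {D L g : Fin n → Fin n → ℝ} (hg : ∀ i j, g i j = -g j i) (hv : ∀ i, |v i| ≤ C)
    (heq : ∀ j, a j - μ * (∑ i, L i j) + ((∑ i, g i j * u i) + ∑ i, v i * (D i j - D j i))
      + Q j = 0) :
    ∑ j, u j * a j ≤ μ * (∑ j, ∑ i, (u j * L i j + D i j ^ 2))
      + n * (C ^ 2 / μ) * (∑ j, u j ^ 2) - ∑ j, u j * Q j := by
  have hg0 : ∑ j, ∑ i, u j * (g i j * u i) = 0 := by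
    have h : ∑ j, ∑ i, u j * (g i j * u i) = -∑ j, ∑ i, u j * (g i j * u i) := by
      conv_lhs => rw [Finset.sum_comm]
      simp only [← Finset.sum_neg_distrib]
      refine Finset.sum_congr rfl fun i _ => Finset.sum_congr rfl fun j _ => ?_
      rw [hg i j]
      ring
    linarith
  have hv0 : ∀ j i, -(u j * (v i * (D i j - D j i)))
      ≤ μ / 2 * D i j ^ 2 + μ / 2 * D j i ^ 2 + C ^ 2 / μ * u j ^ 2 := by
    intro j i
    have hC : v i ^ 2 ≤ C ^ 2 := sq_le_sq' (abs_le.1 (hv i)).1 (abs_le.1 (hv i)).2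
    have h1 : 0 ≤ (μ * D i j + v i * u j) ^ 2 + (μ * D j i - v i * u j) ^ 2 := by positivity
    have h2 : v i ^ 2 * u j ^ 2 ≤ C ^ 2 * u j ^ 2 :=
      mul_le_mul_of_nonneg_right hC (sq_nonneg _)
    have h3 : μ / 2 * D i j ^ 2 + μ / 2 * D j i ^ 2 + C ^ 2 / μ * u j ^ 2
        = (μ ^ 2 * D i j ^ 2 + μ ^ 2 * D j i ^ 2 + 2 * (C ^ 2 * u j ^ 2)) / (2 * μ) := by
      field_simp
    rw [h3, le_div_iff₀ (by positivity)]
    nlinarith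
  have hv1 : -∑ j, ∑ i, u j * (v i * (D i j - D j i))
      ≤ μ * (∑ j, ∑ i, D i j ^ 2) + n * (C ^ 2 / μ) * ∑ j, u j ^ 2 := by
    have hs : ∑ j, ∑ i, D j i ^ 2 = ∑ j, ∑ i, D i j ^ 2 := Finset.sum_comm
    calc -∑ j, ∑ i, u j * (v i * (D i j - D j i))
        = ∑ j, ∑ i, -(u j * (v i * (D i j - D j i))) := by
          simp only [Finset.sum_neg_distrib]
      _ ≤ ∑ j, ∑ i, (μ / 2 * D i j ^ 2 + μ / 2 * D j i ^ 2 + C ^ 2 / μ * u j ^ 2) :=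
          Finset.sum_le_sum fun j _ => Finset.sum_le_sum fun i _ => hv0 j i
      _ = _ := by
          simp only [Finset.sum_add_distrib, ← Finset.mul_sum, hs, Finset.sum_const,
            Finset.card_univ, Fintype.card_fin, nsmul_eq_mul]
          ring
  have ha : ∀ j, u j * a j = μ * (∑ i, u j * L i j) - (∑ i, u j * (g i j * u i))
      - (∑ i, u j * (v i * (D i j - D j i))) - u j * Q j := by
    intro j
    simp only [← Finset.mul_sum]
    linear_combination u j * heq j
  have hsum : ∑ j, u j * a j = μ * (∑ j, ∑ i, u j * L i j)
      - (∑ j, ∑ i, u j * (v i * (D i j - D j i))) - ∑ j, u j * Q j := by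
    simp only [ha, Finset.sum_sub_distrib, hg0, sub_zero, Finset.mul_sum]
  have hsplit : ∑ j, ∑ i, (u j * L i j + D i j ^ 2)
      = (∑ j, ∑ i, u j * L i j) + ∑ j, ∑ i, D i j ^ 2 := by
    simp only [Finset.sum_add_distrib]
  rw [hsum, hsplit]
  linarith

theorem integral_sum_mul_le_of_momentum_eq {μ δ A B B' C : ℝ} (hμ : 0 < μ)
    (hδ : (n : ℝ) / 2 < δ) {u a v : EuclideanSpace ℝ (Fin n) → Fin n → ℝ}
    {g : EuclideanSpace ℝ (Fin n) → Fin n → Fin n → ℝ} {q : EuclideanSpace ℝ (Fin n) → ℝ}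
    (hu : ∀ j, Differentiable ℝ (fun x => u x j))
    (hu' : ∀ i j, Differentiable ℝ (partialDeriv i (fun x => u x j)))
    (ha : ∀ j, Measurable (fun x => a x j)) (hq : Differentiable ℝ q)
    (hu0 : ∀ x j, |u x j| ≤ A * wgt x ^ (-δ))
    (hu1 : ∀ x i j, |partialDeriv i (fun y => u y j) x| ≤ A * wgt x ^ (-δ - 1))
    (hu2 : ∀ x i j, |partialDeriv i (partialDeriv i (fun y => u y j)) x|
      ≤ A * wgt x ^ (-δ - 2))
    (ha0 : ∀ x j, |a x j| ≤ A * wgt x ^ (-δ))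
    (hq0 : ∀ x, |q x| ≤ B * wgt x ^ (1 - δ))
    (hq1 : ∀ x j, |partialDeriv j q x| ≤ B' * wgt x ^ (-δ))
    (hg : ∀ x i j, g x i j = -g x j i) (hv : ∀ x i, |v x i| ≤ C)
    (hdiv : ∀ x, ∑ j, partialDeriv j (fun y => u y j) x = 0)
    (heq : ∀ x j, a x j - μ * (∑ i, partialDeriv i (partialDeriv i (fun y => u y j)) x)
      + ((∑ i, g x i j * u x i) + ∑ i, v x i *
        (partialDeriv i (fun y => u y j) x - partialDeriv j (fun y => u y i) x))
      + partialDeriv j q x = 0) :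
    ∫ x, ∑ j, u x j * a x j ≤ n * (C ^ 2 / μ) * ∫ x, ∑ j, u x j ^ 2 := by
  have hum : ∀ j, Measurable (fun x => u x j) := fun j => (hu j).continuous.measurable
  have hgreen : ∀ i j, _ := fun i j => integral_mul_partialDeriv_partialDeriv hδ i (hu j)
    (hu' i j) (fun x => hu0 x j) (fun x => hu1 x i j) (fun x => hu2 x i j)
  have hIa : Integrable (fun x => ∑ j, u x j * a x j) :=
    integrable_finsetSum _ fun j _ => integrable_mul_of_abs_le_wgt (hum j) (ha j)
      (by linarith) (fun x => hu0 x j) (fun x => ha0 x j)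
  have hIu : Integrable (fun x => ∑ j, u x j ^ 2) := by
    simp only [sq]
    exact integrable_finsetSum _ fun j _ => integrable_mul_of_abs_le_wgt (hum j) (hum j)
      (by linarith) (fun x => hu0 x j) (fun x => hu0 x j)
  have hIq : Integrable (fun x => ∑ j, u x j * partialDeriv j q x) :=
    integrable_finsetSum _ fun j _ => integrable_mul_of_abs_le_wgt (hum j)
      (measurable_partialDeriv j q) (by linarith) (fun x => hu0 x j) (fun x => hq1 x j)
  have hId : Integrable (fun x => ∑ j, ∑ i,
      (u x j * partialDeriv i (partialDeriv i (fun y => u y j)) x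
        + partialDeriv i (fun y => u y j) x ^ 2)) :=
    integrable_finsetSum _ fun j _ => integrable_finsetSum _ fun i _ => (hgreen i j).1
  have hd0 : ∫ x, ∑ j, ∑ i,
      (u x j * partialDeriv i (partialDeriv i (fun y => u y j)) x
        + partialDeriv i (fun y => u y j) x ^ 2) = 0 := by
    rw [integral_finsetSum _ fun j _ => integrable_finsetSum _ fun i _ => (hgreen i j).1]
    refine Finset.sum_eq_zero fun j _ => ?_
    rw [integral_finsetSum _ fun i _ => (hgreen i j).1]
    exact Finset.sum_eq_zero fun i _ => (hgreen i j).2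
  have hq0' := integral_sum_mul_partialDeriv_eq_zero hδ hu hq hu0 (fun x j => hu1 x j j) hq0 hq1
    hdiv
  have hle := integral_mono hIa
    (((hId.const_mul μ).add (hIu.const_mul (n * (C ^ 2 / μ)))).sub hIq)
    (fun x => sum_mul_le_of_momentum_eq hμ (hg x) (hv x) (heq x))
  refine hle.trans_eq ?_
  have h1 := integral_sub ((hId.const_mul μ).add (hIu.const_mul (n * (C ^ 2 / μ)))) hIq
  have h2 := integral_add (hId.const_mul μ) (hIu.const_mul (n * (C ^ 2 / μ)))
  simp only [Pi.add_apply, Pi.sub_apply] at h1 h2 ⊢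
  rw [h1, h2, integral_const_mul, integral_const_mul, hd0, hq0']
  ring

theorem nonpos_of_hasDerivAt_le_mul {f f' : ℝ → ℝ} {K T : ℝ}
    (hf : ContinuousOn f (Set.Icc 0 T))
    (hf' : ∀ t ∈ Set.Ioo 0 T, HasDerivAt f (f' t) t)
    (hle : ∀ t ∈ Set.Ioo 0 T, f' t ≤ K * f t) (h0 : f 0 = 0) {t : ℝ} (ht : t ∈ Set.Icc 0 T) :
    f t ≤ 0 := by
  have hd : ∀ s ∈ Set.Ioo 0 T, HasDerivAt (fun s => f s * Real.exp (-K * s))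
      (f' s * Real.exp (-K * s) + f s * (Real.exp (-K * s) * (-K * 1))) s := fun s hs =>
    (hf' s hs).mul (((hasDerivAt_id s).const_mul (-K)).exp)
  have hanti : AntitoneOn (fun s => f s * Real.exp (-K * s)) (Set.Icc 0 T) := by
    refine antitoneOn_of_deriv_nonpos (convex_Icc 0 T) (hf.mul (by fun_prop)) ?_ ?_
    · rw [interior_Icc]
      exact fun s hs => (hd s hs).differentiableAt.differentiableWithinAt
    · rw [interior_Icc]
      intro s hs
      rw [(hd s hs).deriv]
      nlinarith [hle s hs, Real.exp_pos (-K * s)]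
  have h := hanti ⟨le_rfl, ht.1.trans ht.2⟩ ht ht.1
  simp only [h0, zero_mul] at h
  exact nonpos_of_mul_nonpos_left h (Real.exp_pos _)

theorem continuousOn_integral_sum_sq {T δ A : ℝ} (hδ : (n : ℝ) / 2 < δ)
    {u : EuclideanSpace ℝ (Fin n) → ℝ → Fin n → ℝ}
    (hm : ∀ j, ∀ t ∈ Set.Icc 0 T, Measurable (fun x => u x t j))
    (hc : ∀ x j, ContinuousOn (fun t => u x t j) (Set.Icc 0 T))
    (hu : ∀ x, ∀ t ∈ Set.Icc 0 T, ∀ j, |u x t j| ≤ A * wgt x ^ (-δ)) :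
    ContinuousOn (fun t => ∫ x, ∑ j, u x t j ^ 2) (Set.Icc 0 T) := by
  refine continuousOn_of_dominated (bound := fun x => ∑ _j : Fin n, A * A * wgt x ^ (-2 * δ))
    ?_ ?_ ?_ ?_
  · exact fun t ht => (Finset.measurable_fun_sum _ fun j _ =>
      (hm j t ht).pow_const 2).aestronglyMeasurable
  · refine fun t ht => Eventually.of_forall fun x => ?_
    simp only [Real.norm_eq_abs, sq]
    exact (Finset.abs_sum_le_sum_abs _ _).trans (Finset.sum_le_sum fun j _ =>
      abs_mul_le_wgt (hu x t ht j) (hu x t ht j) (by ring))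
  · exact integrable_finsetSum _ fun j _ => (integrable_wgt_rpow (by linarith)).const_mul _
  · exact Eventually.of_forall fun x => continuousOn_finsetSum _ fun j _ => (hc x j).pow 2

theorem hasDerivAt_integral_sum_sq {T δ A : ℝ} (hδ : (n : ℝ) / 2 < δ)
    {u ut : EuclideanSpace ℝ (Fin n) → ℝ → Fin n → ℝ}
    (hm : ∀ j, ∀ t ∈ Set.Icc 0 T, Measurable (fun x => u x t j))
    (hmt : ∀ j, ∀ t ∈ Set.Icc 0 T, Measurable (fun x => ut x t j))
    (hut : ∀ x j, ∀ t ∈ Set.Icc 0 T,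
      HasDerivWithinAt (fun s => u x s j) (ut x t j) (Set.Icc 0 T) t)
    (hu : ∀ x, ∀ t ∈ Set.Icc 0 T, ∀ j, |u x t j| ≤ A * wgt x ^ (-δ))
    (hutb : ∀ x, ∀ t ∈ Set.Icc 0 T, ∀ j, |ut x t j| ≤ A * wgt x ^ (-δ))
    {t : ℝ} (ht : t ∈ Set.Ioo 0 T) :
    HasDerivAt (fun t => ∫ x, ∑ j, u x t j ^ 2) (2 * ∫ x, ∑ j, u x t j * ut x t j) t := by
  have hsub : Set.Ioo 0 T ⊆ Set.Icc 0 T := Set.Ioo_subset_Icc_self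
  have hnhds : Set.Ioo 0 T ∈ 𝓝 t := isOpen_Ioo.mem_nhds ht
  have key := hasDerivAt_integral_of_dominated_loc_of_deriv_le (μ := volume)
    (F := fun t x => ∑ j, u x t j ^ 2) (F' := fun t x => ∑ j, 2 * (u x t j * ut x t j))
    (bound := fun x => ∑ _j : Fin n, 2 * (A * A * wgt x ^ (-2 * δ))) hnhds ?_ ?_ ?_ ?_ ?_ ?_
  · rw [← integral_const_mul]
    simp only [Finset.mul_sum]
    exact key.2
  · filter_upwards [hnhds] with s hs
    exact (Finset.measurable_fun_sum _ fun j _ =>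
      (hm j s (hsub hs)).pow_const 2).aestronglyMeasurable
  · simp only [sq]
    exact integrable_finsetSum _ fun j _ => integrable_mul_of_abs_le_wgt (hm j t (hsub ht))
      (hm j t (hsub ht)) (by linarith) (fun x => hu x t (hsub ht) j)
      (fun x => hu x t (hsub ht) j)
  · exact (Finset.measurable_fun_sum _ fun j _ =>
      ((hm j t (hsub ht)).mul (hmt j t (hsub ht))).const_mul 2).aestronglyMeasurable
  · refine Eventually.of_forall fun x s hs => ?_
    rw [Real.norm_eq_abs]
    refine (Finset.abs_sum_le_sum_abs _ _).trans (Finset.sum_le_sum fun j _ => ?_)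
    rw [abs_mul, abs_two]
    exact mul_le_mul_of_nonneg_left
      (abs_mul_le_wgt (hu x s (hsub hs) j) (hutb x s (hsub hs) j) (by ring)) zero_le_two
  · exact integrable_finsetSum _ fun j _ =>
      ((integrable_wgt_rpow (by linarith)).const_mul _).const_mul _
  · refine Eventually.of_forall fun x s hs => HasDerivAt.fun_sum fun j _ => ?_
    have h := ((hut x j s (hsub hs)).hasDerivAt
      (Icc_mem_nhds hs.1 hs.2)).fun_pow 2
    exact h.congr_deriv (by push_cast; ring)

theorem eq_zero_of_integral_sum_sq_nonpos {δ A : ℝ} (hδ : (n : ℝ) / 2 < δ)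
    {u : EuclideanSpace ℝ (Fin n) → Fin n → ℝ} (hc : ∀ j, Continuous (fun x => u x j))
    (hu : ∀ x j, |u x j| ≤ A * wgt x ^ (-δ)) (h : ∫ x, ∑ j, u x j ^ 2 ≤ 0)
    (x : EuclideanSpace ℝ (Fin n)) (j : Fin n) : u x j = 0 := by
  have hnn : ∀ x, 0 ≤ ∑ j, u x j ^ 2 := fun x => Finset.sum_nonneg fun j _ => sq_nonneg _
  have h_int : Integrable (fun x => ∑ j, u x j ^ 2) := by
    simp only [sq]
    exact integrable_finsetSum _ fun j _ => integrable_mul_of_abs_le_wgt (hc j).measurable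
      (hc j).measurable (by linarith) (fun x => hu x j) (fun x => hu x j)
  have h0 := (integral_eq_zero_iff_of_nonneg hnn h_int).1 (le_antisymm h (integral_nonneg hnn))
  have hcont : Continuous (fun x => ∑ j, u x j ^ 2) :=
    continuous_finsetSum _ fun j _ => (hc j).pow 2
  have hx : ∑ j, u x j ^ 2 = 0 :=
    congrFun ((hcont.ae_eq_iff_eq volume continuous_zero).1 h0) x
  exact pow_eq_zero_iff two_ne_zero |>.1
    ((Finset.sum_eq_zero_iff_of_nonneg fun j _ => sq_nonneg _).1 hx j (Finset.mem_univ j))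

theorem tendsto_wgt_rpow_cocompact {a : ℝ} (ha : a < 0) :
    Tendsto (fun x : EuclideanSpace ℝ (Fin n) => wgt x ^ a) (cocompact _) (𝓝 0) := by
  have hw : Tendsto (fun x : EuclideanSpace ℝ (Fin n) => wgt x) (cocompact _) atTop :=
    tendsto_atTop_mono norm_le_wgt tendsto_norm_cocompact_atTop
  simpa [Function.comp_def] using (tendsto_rpow_neg_atTop (neg_pos.2 ha)).comp hw

/-- A function with vanishing gradient and decay at infinity vanishes. -/
theorem eq_zero_of_partialDeriv_eq_zero (hn : 1 ≤ n) {a B : ℝ} (ha : a < 0)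
    {f : EuclideanSpace ℝ (Fin n) → ℝ} (hf : Differentiable ℝ f)
    (hf' : ∀ x j, partialDeriv j f x = 0) (hfB : ∀ x, |f x| ≤ B * wgt x ^ a)
    (x : EuclideanSpace ℝ (Fin n)) : f x = 0 := by
  have hfd : ∀ x, fderiv ℝ f x = 0 := by
    intro x
    apply ContinuousLinearMap.coe_injective
    refine (EuclideanSpace.basisFun (Fin n) ℝ).toBasis.ext fun j => ?_
    simpa [partialDeriv] using hf' x j
  have hconst := is_const_of_fderiv_eq_zero hf hfd
  have : Nonempty (Fin n) := ⟨⟨0, hn⟩⟩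
  have h0 : Tendsto (fun y : EuclideanSpace ℝ (Fin n) => B * wgt y ^ a) (cocompact _) (𝓝 0) := by
    simpa using (tendsto_wgt_rpow_cocompact ha).const_mul B
  have hle : |f x| ≤ 0 := ge_of_tendsto' h0 fun y => by
    rw [hconst x y]
    exact hfB y
  exact abs_nonpos_iff.1 hle

end Weight

/-- uniqueness for the linearised Navier–Stokes equations in the layer
`ℝⁿ × [0,T]` (`δ > n/2`): a divergence-free vector field `u` with the stated weighted bounds,
and a pressure `p` with the stated weighted bounds, solving
`∂_t u − μΔu + V₀u + ∇p = 0` with `u(·,0) = 0`, vanish identically. -/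
theorem statement18 (n : ℕ) (hn : 2 ≤ n) (μ T δ : ℝ) (hμ : 0 < μ) (hT : 0 < T)
    (hδ : (n : ℝ) / 2 < δ) (C M : ℝ)
    (g : EuclideanSpace ℝ (Fin n) → ℝ → Fin n → Fin n → ℝ)
    (v1 v2 : EuclideanSpace ℝ (Fin n) → ℝ → Fin n → ℝ)
    -- hypotheses on the coefficients
    (hgC : ∀ i j : Fin n, ContinuousOn
      (fun z : EuclideanSpace ℝ (Fin n) × ℝ => g z.1 z.2 i j) (Set.univ ×ˢ Set.Icc (0 : ℝ) T))
    (hganti : ∀ x t i j, g x t i j = -g x t j i)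
    (hgB : ∀ x t, t ∈ Set.Icc (0 : ℝ) T → ∀ i j, |g x t i j| ≤ C)
    (hv1C : ∀ i : Fin n, ContinuousOn
      (fun z : EuclideanSpace ℝ (Fin n) × ℝ => v1 z.1 z.2 i) (Set.univ ×ˢ Set.Icc (0 : ℝ) T))
    (hv1B : ∀ x t, t ∈ Set.Icc (0 : ℝ) T → ∀ i, |v1 x t i| ≤ C)
    (hv2C : ∀ i : Fin n, ContinuousOn
      (fun z : EuclideanSpace ℝ (Fin n) × ℝ => v2 z.1 z.2 i) (Set.univ ×ˢ Set.Icc (0 : ℝ) T))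
    (hv2d : ∀ (i : Fin n) x (t : ℝ), t ∈ Set.Icc (0 : ℝ) T →
      DifferentiableAt ℝ (fun y => v2 y t i) x)
    (hv2B : ∀ x t, t ∈ Set.Icc (0 : ℝ) T → ∀ i, |v2 x t i| ≤ C * wgt x)
    (hv2dB : ∀ x t, t ∈ Set.Icc (0 : ℝ) T → ∀ i j, |pdx j (fun y s => v2 y s i) x t| ≤ C)
    -- regularity of u
    (u ut : EuclideanSpace ℝ (Fin n) → ℝ → Fin n → ℝ)
    (huC : ∀ j : Fin n, ContinuousOn
      (fun z : EuclideanSpace ℝ (Fin n) × ℝ => u z.1 z.2 j) (Set.univ ×ˢ Set.Icc (0 : ℝ) T))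
    (hud1 : ∀ (j : Fin n) x (t : ℝ), t ∈ Set.Icc (0 : ℝ) T →
      DifferentiableAt ℝ (fun y => u y t j) x)
    (hud2 : ∀ (i j : Fin n) x (t : ℝ), t ∈ Set.Icc (0 : ℝ) T →
      DifferentiableAt ℝ (fun y => pdx i (fun y' s => u y' s j) y t) x)
    (huC1 : ∀ i j : Fin n, ContinuousOn
      (fun z : EuclideanSpace ℝ (Fin n) × ℝ => pdx i (fun y s => u y s j) z.1 z.2)
      (Set.univ ×ˢ Set.Icc (0 : ℝ) T))
    (huC2 : ∀ i i' j : Fin n, ContinuousOn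
      (fun z : EuclideanSpace ℝ (Fin n) × ℝ =>
        pdx i' (pdx i (fun y s => u y s j)) z.1 z.2) (Set.univ ×ˢ Set.Icc (0 : ℝ) T))
    (hut : ∀ (j : Fin n) x (t : ℝ), t ∈ Set.Icc (0 : ℝ) T →
      HasDerivWithinAt (fun s => u x s j) (ut x t j) (Set.Icc (0 : ℝ) T) t)
    (hutC : ∀ j : Fin n, ContinuousOn
      (fun z : EuclideanSpace ℝ (Fin n) × ℝ => ut z.1 z.2 j) (Set.univ ×ˢ Set.Icc (0 : ℝ) T))
    -- weighted bounds on u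
    (hub0 : ∀ x t, t ∈ Set.Icc (0 : ℝ) T → ∀ j, |u x t j| ≤ M * wgt x ^ (-δ))
    (hub1 : ∀ x t, t ∈ Set.Icc (0 : ℝ) T → ∀ i j,
      |pdx i (fun y s => u y s j) x t| ≤ M * wgt x ^ (-δ - 1))
    (hub2 : ∀ x t, t ∈ Set.Icc (0 : ℝ) T → ∀ i i' j,
      |pdx i' (pdx i (fun y s => u y s j)) x t| ≤ M * wgt x ^ (-δ - 2))
    (hubt : ∀ x t, t ∈ Set.Icc (0 : ℝ) T → ∀ j, |ut x t j| ≤ M * wgt x ^ (-δ))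
    -- regularity of and weighted bounds on p
    (p : EuclideanSpace ℝ (Fin n) → ℝ → ℝ)
    (hpC : ContinuousOn (fun z : EuclideanSpace ℝ (Fin n) × ℝ => p z.1 z.2)
      (Set.univ ×ˢ Set.Icc (0 : ℝ) T))
    (hpd : ∀ x (t : ℝ), t ∈ Set.Icc (0 : ℝ) T → DifferentiableAt ℝ (fun y => p y t) x)
    (hpb0 : ∀ x t, t ∈ Set.Icc (0 : ℝ) T → |p x t| ≤ M * wgt x ^ (1 - δ))
    (hpb1 : ∀ x t, t ∈ Set.Icc (0 : ℝ) T → ∀ j, |pdx j p x t| ≤ M * wgt x ^ (-δ))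
    -- the equations
    (hdiv : ∀ x (t : ℝ), t ∈ Set.Icc (0 : ℝ) T →
      ∑ i, pdx i (fun y s => u y s i) x t = 0)
    (heq : ∀ (j : Fin n) x (t : ℝ), 0 < t → t < T →
      ut x t j - μ * (∑ i, pdx i (pdx i (fun y s => u y s j)) x t)
        + V0 g v1 v2 u j x t + pdx j p x t = 0)
    (hinit : ∀ x j, u x 0 j = 0) :
    ∀ x (t : ℝ), t ∈ Set.Icc (0 : ℝ) T → (∀ j, u x t j = 0) ∧ p x t = 0 := by
  have hδ1 : 1 - δ < 0 := by
    have : (2 : ℝ) ≤ n := by exact_mod_cast hn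
    linarith
  have hslice : ∀ t ∈ Set.Icc (0 : ℝ) T, ∀ f : EuclideanSpace ℝ (Fin n) × ℝ → ℝ,
      ContinuousOn f (Set.univ ×ˢ Set.Icc (0 : ℝ) T) → Continuous (fun x => f (x, t)) :=
    fun t ht f hf => hf.comp_continuous (by fun_prop) fun x => ⟨Set.mem_univ _, ht⟩
  have hum : ∀ j, ∀ t ∈ Set.Icc (0 : ℝ) T, Measurable (fun x => u x t j) :=
    fun j t ht => (hslice t ht _ (huC j)).measurable
  have hutm : ∀ j, ∀ t ∈ Set.Icc (0 : ℝ) T, Measurable (fun x => ut x t j) :=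
    fun j t ht => (hslice t ht _ (hutC j)).measurable
  have henergy : ∀ t ∈ Set.Ioo (0 : ℝ) T,
      2 * ∫ x, ∑ j, u x t j * ut x t j
        ≤ 2 * (n * (C ^ 2 / μ)) * ∫ x, ∑ j, u x t j ^ 2 := by
    intro t ht
    have ht' : t ∈ Set.Icc (0 : ℝ) T := Set.Ioo_subset_Icc_self ht
    have hv2u : Differentiable ℝ (fun y => ∑ i, v2 y t i * u y t i) := fun x =>
      DifferentiableAt.fun_sum fun i _ => (hv2d i x t ht').mul (hud1 i x t ht')
    have hpt : Differentiable ℝ (fun y => p y t) := fun x => hpd x t ht'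
    have hqadd : ∀ x j, partialDeriv j (fun y => p y t + ∑ i, v2 y t i * u y t i) x
        = pdx j p x t + pdx j (fun y s => ∑ i, v2 y s i * u y s i) x t := by
      intro x j
      simp only [partialDeriv, pdx]
      rw [fderiv_fun_add (hpt x) (hv2u x)]
      rfl
    have hv2uj : ∀ x j, pdx j (fun y s => ∑ i, v2 y s i * u y s i) x t
        = ∑ i, (pdx j (fun y s => v2 y s i) x t * u x t i
          + v2 x t i * pdx j (fun y s => u y s i) x t) := by
      intro x j
      simp only [pdx]
      rw [fderiv_fun_sum fun i _ => (hv2d i x t ht').fun_mul (hud1 i x t ht')]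
      rw [sum_apply]
      exact Finset.sum_congr rfl fun i _ =>
        partialDeriv_mul j (hv2d i x t ht') (hud1 i x t ht')
    have hv2B' : ∀ x i, |v2 x t i| ≤ C * wgt x ^ (1 : ℝ) := fun x i => by
      simpa using hv2B x t ht' i
    have hv2dB' : ∀ x i j, |pdx j (fun y s => v2 y s i) x t| ≤ C * wgt x ^ (0 : ℝ) :=
      fun x i j => by simpa using hv2dB x t ht' i j
    have hq0 : ∀ x, |p x t + ∑ i, v2 x t i * u x t i|
        ≤ (M + n * (C * M)) * wgt x ^ (1 - δ) := by
      intro x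
      calc |p x t + ∑ i, v2 x t i * u x t i|
          ≤ |p x t| + ∑ i, |v2 x t i * u x t i| :=
            (abs_add_le _ _).trans (by gcongr; exact Finset.abs_sum_le_sum_abs _ _)
        _ ≤ M * wgt x ^ (1 - δ) + ∑ _i : Fin n, C * M * wgt x ^ (1 - δ) :=
            add_le_add (hpb0 x t ht') (Finset.sum_le_sum fun i _ =>
              abs_mul_le_wgt (hv2B' x i) (hub0 x t ht' i) (by ring))
        _ = _ := by
            rw [Finset.sum_const, Finset.card_univ, Fintype.card_fin, nsmul_eq_mul]
            ring
    have hq1 : ∀ x j, |partialDeriv j (fun y => p y t + ∑ i, v2 y t i * u y t i) x|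
        ≤ (M + n * (2 * (C * M))) * wgt x ^ (-δ) := by
      intro x j
      rw [hqadd, hv2uj]
      calc _ ≤ |pdx j p x t| + ∑ i, (|pdx j (fun y s => v2 y s i) x t * u x t i|
              + |v2 x t i * pdx j (fun y s => u y s i) x t|) :=
            (abs_add_le _ _).trans (by
              gcongr
              exact (Finset.abs_sum_le_sum_abs _ _).trans
                (Finset.sum_le_sum fun i _ => abs_add_le _ _))
        _ ≤ M * wgt x ^ (-δ) + ∑ _i : Fin n, (C * M * wgt x ^ (-δ) + C * M * wgt x ^ (-δ)) :=
            add_le_add (hpb1 x t ht' j) (Finset.sum_le_sum fun i _ => add_le_add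
              (abs_mul_le_wgt (hv2dB' x i j) (hub0 x t ht' i) (by ring))
              (abs_mul_le_wgt (hv2B' x i) (hub1 x t ht' j i) (by ring)))
        _ = _ := by
            rw [Finset.sum_const, Finset.card_univ, Fintype.card_fin, nsmul_eq_mul]
            ring
    have hring : ∀ a b c d e : ℝ, a - b + c + (e + d) = a - b + (c + d) + e := by
      intros
      ring
    have h := integral_sum_mul_le_of_momentum_eq (u := fun x => u x t) (a := fun x => ut x t)
      (v := fun x => v1 x t) (g := fun x => g x t) hμ hδ
      (fun j x => hud1 j x t ht') (fun i j x => hud2 i j x t ht') (fun j => hutm j t ht')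
      (hpt.add hv2u) (fun x j => hub0 x t ht' j) (fun x i j => hub1 x t ht' i j)
      (fun x i j => hub2 x t ht' i i j) (fun x j => hubt x t ht' j) hq0 hq1
      (fun x i j => hganti x t i j) (fun x i => hv1B x t ht' i) (fun x => hdiv x t ht')
      (fun x j => by
        have hq := hqadd x j
        have he := heq j x t ht.1 ht.2
        simp only [V0] at he
        refine Eq.trans ?_ he
        refine (congrArg _ hq).trans ?_
        exact hring _ _ _ _ _)
    linarith
  have hE0 : ∀ t ∈ Set.Icc (0 : ℝ) T, ∫ x, ∑ j, u x t j ^ 2 ≤ 0 := fun t ht =>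
    nonpos_of_hasDerivAt_le_mul (f := fun t => ∫ x, ∑ j, u x t j ^ 2)
      (continuousOn_integral_sum_sq hδ hum
        (fun x j s hs => (hut j x s hs).continuousWithinAt) hub0)
      (fun s hs => hasDerivAt_integral_sum_sq hδ hum hutm (fun x j s hs => hut j x s hs)
        hub0 hubt hs)
      henergy (by simp [hinit]) ht
  have hu0 : ∀ x, ∀ t ∈ Set.Icc (0 : ℝ) T, ∀ j, u x t j = 0 := fun x t ht j =>
    eq_zero_of_integral_sum_sq_nonpos (u := fun x => u x t) hδ
      (fun j => hslice t ht _ (huC j)) (fun x j => hub0 x t ht j) (hE0 t ht) x j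
  have hp0 : ∀ x, ∀ t ∈ Set.Ioo (0 : ℝ) T, p x t = 0 := by
    intro x t ht
    have ht' : t ∈ Set.Icc (0 : ℝ) T := Set.Ioo_subset_Icc_self ht
    refine eq_zero_of_partialDeriv_eq_zero (f := fun y => p y t) (by omega) hδ1
      (fun y => hpd y t ht') (fun y j => ?_) (fun y => hpb0 y t ht') x
    have hut0 : ut y t j = 0 := by
      have h := (hut j y t ht').hasDerivAt (Icc_mem_nhds ht.1 ht.2)
      refine h.unique ((hasDerivAt_const t (0 : ℝ)).congr_of_eventuallyEq ?_)
      filter_upwards [Icc_mem_nhds ht.1 ht.2] with s hs using hu0 y s hs j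
    have he := heq j y t ht.1 ht.2
    simpa [V0, pdx, partialDeriv, hut0, fun y => hu0 y t ht'] using he
  refine fun x t ht => ⟨hu0 x t ht, ?_⟩
  have hpc : ContinuousOn (fun s => p x s) (Set.Icc 0 T) :=
    hpC.comp (by fun_prop : Continuous fun s : ℝ => (x, s)).continuousOn
      fun s hs => ⟨Set.mem_univ _, hs⟩
  have hEq : Set.EqOn (fun s => p x s) (fun _ => 0) (Set.Icc 0 T) :=
    Set.EqOn.of_subset_closure (hp0 x) hpc continuousOn_const Set.Ioo_subset_Icc_self
      (closure_Ioo hT.ne).ge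
  exact hEq ht
end
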